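/- arXiv:0912.4977 — 2 statements merged into one kernel-verified Lean document; each statement's English description precedes it below -/
import Mathlib

section
/- For every S ⊆ 𝒫, one has lim_{x→∞} ∏_{p prime, p ≤ x} P_p(S) > 0 if and only if both the empty partition 0 and the unique partition 1 of 1 belong to S. -/
open Filter Topology

/-- The type of all integer partitions (of all natural numbers `n`). -/
def PartitionsAll : Type := Σ n : ℕ, Nat.Partition n

/-- The empty partition of `0`. -/
def partZero : PartitionsAll := ⟨0, ⟨0, by simp, rfl⟩⟩

/-- The unique partition of `1`. -/
def partOne : PartitionsAll :=
  ⟨1, ⟨{1}, by intro i hi; rw [Multiset.mem_singleton] at hi; omega, rfl⟩⟩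

instance : Zero PartitionsAll := ⟨partZero⟩

/-- The set of isomorphism classes of finite abelian groups, identified with the
finitely supported families of partitions indexed by the primes. -/
abbrev GG : Type := Nat.Primes →₀ PartitionsAll

/-- The finite abelian `p`-group `⊕ⱼ ℤ/p^{λ_j}ℤ` corresponding to a partition `λ`. -/
abbrev pGroup (p : ℕ) (lam : PartitionsAll) : Type :=
  ∀ i : Fin lam.2.parts.toList.length, ZMod (p ^ lam.2.parts.toList.get i)

/-- The Cohen–Lenstra weight `w_p(λ) = 1/#Aut(G_{p,λ})`. -/
noncomputable def wCL (p : ℕ) (lam : PartitionsAll) : ℝ :=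
  ((Nat.card (AddAut (pGroup p lam)) : ℝ))⁻¹

/-- `∏_{i=1}^∞ (1 - p^{-i})`. -/
noncomputable def clC (p : ℕ) : ℝ := ∏' i : ℕ, (1 - ((p : ℝ))⁻¹ ^ (i + 1))

/-- The local Cohen–Lenstra probability `P_p(S) = (∑_{λ∈S} w_p(λ)) ∏_{i≥1}(1-p^{-i})`. -/
noncomputable def Pp (p : ℕ) (S : Set PartitionsAll) : ℝ :=
  (∑' lam : S, wCL p lam) * clC p

/-- The primes `≤ x`. -/
def primesUpTo (x : ℕ) : Finset ℕ := Nat.primesBelow (x + 1)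

/-- The partial products `∏_{p ≤ x} P_p(S)`. -/
noncomputable def globPartial (S : Set PartitionsAll) (x : ℕ) : ℝ :=
  ∏ p ∈ primesUpTo x, Pp p S

/-- The global value `lim_{x→∞} ∏_{p ≤ x} P_p(S)` (the limit exists since all
factors lie in `[0,1]`). -/
noncomputable def glob (S : Set PartitionsAll) : ℝ :=
  limUnder atTop (globPartial S)

/-- `O(S) = {G : G_p ∈ S for all primes p}`. -/
def Oset (S : Set PartitionsAll) : Set GG := {G : GG | ∀ p : Nat.Primes, G p ∈ S}

/-- `O(E₁, …, E_r) = O(E₁) ∪ … ∪ O(E_r)`. -/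
def OOset {r : ℕ} (E : Fin r → Set PartitionsAll) : Set GG := ⋃ i, Oset (E i)

/-- Inclusion–exclusion value of `O(E₁, …, E_r)`. -/
noncomputable def PO {r : ℕ} (E : Fin r → Set PartitionsAll) : ℝ :=
  ∑ T ∈ Finset.univ.filter (fun T : Finset (Fin r) => T.Nonempty),
    (-1 : ℝ) ^ (T.card + 1) * glob (⋂ i ∈ T, E i)

/-- The collection `𝔇` of sets `D(E₁,…,E_r;F₁,…,F_s)`. -/
def DD : Set (Set GG) :=
  {A | ∃ (r s : ℕ) (E : Fin r → Set PartitionsAll) (F : Fin s → Set PartitionsAll),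
      OOset F ⊆ OOset E ∧ A = OOset E \ OOset F}

/-- The value `P(D)` of a set `D ∈ 𝔇` (well-defined: it depends only on the set `D`). -/
noncomputable def PDval (A : Set GG) : ℝ :=
  sSup {x : ℝ | ∃ (r s : ℕ) (E : Fin r → Set PartitionsAll) (F : Fin s → Set PartitionsAll),
      OOset F ⊆ OOset E ∧ A = OOset E \ OOset F ∧ x = PO E - PO F}

/-- The outer measure `ν`. -/
noncomputable def nuCL (A : Set GG) : ℝ :=
  sInf {x : ℝ | ∃ C : ℕ → Set GG, (∀ i, C i ∈ DD) ∧ A ⊆ ⋃ i, C i ∧ x = ∑' i, PDval (C i)}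

/-- The order of a finite abelian group. -/
def ordG (G : GG) : ℕ := G.prod fun p lam => (p : ℕ) ^ lam.1

/-- The exponent of a finite abelian group. -/
def expG (G : GG) : ℕ := G.prod fun p lam => (p : ℕ) ^ lam.2.parts.sup

/-- The finite abelian `p`-group attached to a list of exponents. -/
abbrev listGroup (p : ℕ) (l : List ℕ) : Type :=
  ∀ i : Fin l.length, ZMod (p ^ l.get i)

/-- The lower triangular automorphism of a product `A × B`. -/
def triangularAddAut {A B : Type*} [AddCommGroup A] [AddCommGroup B]
    (t : AddAut A × (A →+ B) × AddAut B) : AddAut (A × B) where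
  toFun x := (t.1 x.1, t.2.1 x.1 + t.2.2 x.2)
  invFun x := (t.1.symm x.1, t.2.2.symm (x.2 - t.2.1 (t.1.symm x.1)))
  left_inv x := by ext <;> simp
  right_inv x := by ext <;> simp
  map_add' x y := by
    ext
    · simp
    · simp only [Prod.fst_add, Prod.snd_add, map_add]; abel

theorem triangularAddAut_injective {A B : Type*} [AddCommGroup A] [AddCommGroup B] :
    Function.Injective (triangularAddAut (A := A) (B := B)) := by
  rintro ⟨α, h, β⟩ ⟨α', h', β'⟩ heq
  have key : ∀ a b, α a = α' a ∧ h a + β b = h' a + β' b := fun a b => by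
    have := DFunLike.congr_fun heq (a, b)
    simpa [triangularAddAut] using this
  have h1 : α = α' := AddEquiv.ext fun a => (key a 0).1
  have h2 : h = h' := AddMonoidHom.ext fun a => by simpa using (key a 0).2
  have h3 : β = β' := AddEquiv.ext fun b => by simpa using (key 0 b).2
  rw [h1, h2, h3]

instance finite_addAut {A : Type*} [AddCommGroup A] [Finite A] : Finite (AddAut A) :=
  Finite.of_injective (fun f : AddAut A => (f : A → A)) DFunLike.coe_injective

theorem card_addAut_prod_ge {A B : Type*} [AddCommGroup A] [AddCommGroup B] [Finite A] [Finite B] :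
    Nat.card (AddAut A) * (Nat.card (A →+ B) * Nat.card (AddAut B)) ≤
      Nat.card (AddAut (A × B)) := by
  rw [← Nat.card_prod, ← Nat.card_prod]
  exact Nat.card_le_card_of_injective _ triangularAddAut_injective

theorem card_addAut_congr {A B : Type*} [AddCommGroup A] [AddCommGroup B] (e : A ≃+ B) :
    Nat.card (AddAut A) = Nat.card (AddAut B) :=
  Nat.card_congr
    { toFun := fun f => (e.symm.trans f).trans e
      invFun := fun f => (e.trans f).trans e.symm
      left_inv := fun f => by ext; simp
      right_inv := fun f => by ext; simp }

theorem card_addAut_zmod (n : ℕ) [NeZero n] : Nat.card (AddAut (ZMod n)) = n.totient := by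
  rw [Nat.card_congr (ZMod.AddAutEquivUnits n).toEquiv, ← ZMod.card_units_eq_totient n,
    ← Nat.card_eq_fintype_card]
  rfl

/-- The list group of a nonempty list splits off its first factor. -/
def listGroupCons (p k : ℕ) (l : List ℕ) :
    (ZMod (p ^ k) × listGroup p l) ≃+ listGroup p (k :: l) :=
  (Fin.consLinearEquiv ℕ
    (fun i : Fin (l.length + 1) => ZMod (p ^ (k :: l).get i))).toAddEquiv

theorem pow_length_le_card_hom {p k : ℕ} (hp : p.Prime) (hk : 1 ≤ k) {l : List ℕ}
    (hl : ∀ i ∈ l, 1 ≤ i) :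
    p ^ l.length ≤ Nat.card (ZMod (p ^ k) →+ listGroup p l) := by
  have : NeZero p := ⟨hp.ne_zero⟩
  have hpos : ∀ j : Fin l.length, 1 ≤ l.get j := fun j => hl _ (l.get_mem j)
  let x : (Fin l.length → Fin p) → listGroup p l :=
    fun t j => (((t j : ℕ) * p ^ (l.get j - 1) : ℕ) : ZMod (p ^ l.get j))
  have hx : ∀ t, (p ^ k) • x t = 0 := by
    intro t
    funext j
    have : p ^ l.get j ∣ p ^ k * ((t j : ℕ) * p ^ (l.get j - 1)) := by
      calc p ^ l.get j = p ^ 1 * p ^ (l.get j - 1) := by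
            rw [← pow_add]; congr 1; have := hpos j; omega
        _ ∣ p ^ k * p ^ (l.get j - 1) := mul_dvd_mul_right (pow_dvd_pow p hk) _
        _ ∣ _ := mul_dvd_mul_left _ (dvd_mul_left _ _)
    have h0 := (ZMod.natCast_eq_zero_iff _ _).2 this
    rw [Nat.cast_mul] at h0
    simpa [x, nsmul_eq_mul] using h0
  have hxinj : Function.Injective x := by
    intro t s hts
    funext j
    have hj := congrFun hts j
    simp only [x] at hj
    have hlt : ∀ a : Fin p, (a : ℕ) * p ^ (l.get j - 1) < p ^ l.get j := fun a => by
      calc (a : ℕ) * p ^ (l.get j - 1) < p * p ^ (l.get j - 1) :=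
            Nat.mul_lt_mul_of_pos_right a.2 (pow_pos hp.pos _)
        _ = p ^ l.get j := by rw [← pow_succ']; congr 1; have := hpos j; omega
    rw [ZMod.natCast_eq_natCast_iff', Nat.mod_eq_of_lt (hlt _), Nat.mod_eq_of_lt (hlt _)] at hj
    exact Fin.ext (Nat.eq_of_mul_eq_mul_right (pow_pos hp.pos _) hj)
  let F : (Fin l.length → Fin p) → (ZMod (p ^ k) →+ listGroup p l) := fun t =>
    ZMod.lift (p ^ k) ⟨zmultiplesHom _ (x t), by
      rw [zmultiplesHom_apply, natCast_zsmul]; exact hx t⟩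
  have hF : Function.Injective F := by
    intro t s hts
    apply hxinj
    have h1 : ∀ t, F t ((1 : ℤ) : ZMod (p ^ k)) = x t := fun t => by
      simp only [F, ZMod.lift_coe, zmultiplesHom_apply, one_zsmul]
    rw [← h1, ← h1, hts]
  have : Finite (ZMod (p ^ k) →+ listGroup p l) :=
    Finite.of_injective (fun f : ZMod (p ^ k) →+ listGroup p l => (f : _ → _))
      DFunLike.coe_injective
  simpa using Nat.card_le_card_of_injective F hF

theorem card_addAut_cons_ge {p k : ℕ} (hp : p.Prime) (hk : 1 ≤ k) {l : List ℕ}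
    (hl : ∀ i ∈ l, 1 ≤ i) :
    p ^ (k - 1) * (p - 1) * (p ^ l.length * Nat.card (AddAut (listGroup p l))) ≤
      Nat.card (AddAut (listGroup p (k :: l))) := by
  have : NeZero p := ⟨hp.ne_zero⟩
  rw [← card_addAut_congr (listGroupCons p k l)]
  refine le_trans ?_ card_addAut_prod_ge
  rw [card_addAut_zmod, Nat.totient_prime_pow hp hk]
  gcongr
  exact pow_length_le_card_hom hp hk hl

theorem card_addAut_nil (p : ℕ) : Nat.card (AddAut (listGroup p [])) = 1 := by
  have : Subsingleton (listGroup p []) := ⟨fun a b => funext fun i => i.elim0⟩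
  have : Unique (AddAut (listGroup p [])) :=
    { default := 0, uniq := fun f => AddEquiv.ext fun x => Subsingleton.elim _ _ }
  exact Nat.card_unique

theorem card_addAut_singleton {p : ℕ} (hp : p.Prime) :
    Nat.card (AddAut (listGroup p [1])) = p - 1 := by
  have : NeZero p := ⟨hp.ne_zero⟩
  have : Subsingleton (listGroup p []) := ⟨fun a b => funext fun i => i.elim0⟩
  have : Unique (listGroup p []) := Unique.mk' _
  rw [← card_addAut_congr (listGroupCons p 1 []), card_addAut_congr
    (AddEquiv.prodUnique : ZMod (p ^ 1) × listGroup p [] ≃+ ZMod (p ^ 1)), card_addAut_zmod,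
    Nat.totient_prime_pow hp one_pos]
  simp

open scoped ENNReal

/-- The inverse number of automorphisms of the group of a list of positive exponents,
extended by zero to all lists. -/
noncomputable def listWeight (p : ℕ) (l : List ℕ) : ℝ≥0∞ :=
  if ∀ i ∈ l, 1 ≤ i then (Nat.card (AddAut (listGroup p l)) : ℝ≥0∞)⁻¹ else 0

theorem inv_prime_le_half {p : ℕ} (hp : p.Prime) : (p : ℝ≥0∞)⁻¹ ≤ 2⁻¹ :=
  ENNReal.inv_le_inv.2 (by exact_mod_cast hp.two_le)

theorem listWeight_nil (p : ℕ) : listWeight p [] = 1 := by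
  simp [listWeight, card_addAut_nil]

theorem listWeight_zero_cons (p : ℕ) (l : List ℕ) : listWeight p (0 :: l) = 0 := by
  simp [listWeight]

theorem listWeight_cons_le {p : ℕ} (hp : p.Prime) (k : ℕ) (l : List ℕ) :
    listWeight p ((k + 1) :: l) ≤
      2 * (p : ℝ≥0∞)⁻¹ ^ (l.length + 1) * ((p : ℝ≥0∞)⁻¹ ^ k * listWeight p l) := by
  by_cases hl : ∀ i ∈ l, 1 ≤ i
  · have hl' : ∀ i ∈ (k + 1) :: l, 1 ≤ i := by simpa using hl
    rw [listWeight, listWeight, if_pos hl, if_pos hl']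
    have h := card_addAut_cons_ge hp (Nat.succ_pos k) hl
    have hc : p ^ (l.length + 1) * (p ^ k * Nat.card (AddAut (listGroup p l))) ≤
        2 * Nat.card (AddAut (listGroup p ((k + 1) :: l))) := by
      have h2 : p ≤ 2 * (p - 1) := by have := hp.two_le; omega
      calc _ = p * (p ^ k * (p ^ l.length * Nat.card (AddAut (listGroup p l)))) := by ring
        _ ≤ 2 * (p - 1) * (p ^ k * (p ^ l.length * Nat.card (AddAut (listGroup p l)))) := by gcongr
        _ = 2 * (p ^ k * (p - 1) * (p ^ l.length * Nat.card (AddAut (listGroup p l)))) := by ring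
        _ ≤ _ := by gcongr; exact h
    have hc' : (p : ℝ≥0∞) ^ (l.length + 1) *
        ((p : ℝ≥0∞) ^ k * (Nat.card (AddAut (listGroup p l)) : ℝ≥0∞)) ≤
        2 * (Nat.card (AddAut (listGroup p ((k + 1) :: l))) : ℝ≥0∞) := by exact_mod_cast hc
    have hinv := ENNReal.inv_le_inv.2 hc'
    have hp0 : (p : ℝ≥0∞) ≠ 0 := by exact_mod_cast hp.ne_zero
    have hpt : (p : ℝ≥0∞) ≠ ⊤ := ENNReal.natCast_ne_top p
    rw [ENNReal.mul_inv (Or.inl two_ne_zero) (Or.inl ENNReal.ofNat_ne_top),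
      ENNReal.mul_inv (Or.inl (pow_ne_zero _ hp0)) (Or.inl (ENNReal.pow_ne_top hpt)),
      ENNReal.mul_inv (Or.inl (pow_ne_zero _ hp0)) (Or.inl (ENNReal.pow_ne_top hpt)),
      ENNReal.inv_pow, ENNReal.inv_pow] at hinv
    calc _ = 2 * (2⁻¹ * (Nat.card (AddAut (listGroup p ((k + 1) :: l))) : ℝ≥0∞)⁻¹) := by
          rw [← mul_assoc, ENNReal.mul_inv_cancel two_ne_zero ENNReal.ofNat_ne_top, one_mul]
      _ ≤ _ := by rw [mul_assoc]; gcongr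
  · have hl' : ¬ ∀ i ∈ (k + 1) :: l, 1 ≤ i := by simpa using hl
    rw [listWeight, if_neg hl']
    exact zero_le

theorem tsum_inv_prime_pow_le {p : ℕ} (hp : p.Prime) : ∑' k : ℕ, (p : ℝ≥0∞)⁻¹ ^ k ≤ 2 := by
  calc _ ≤ ∑' k : ℕ, (2 : ℝ≥0∞)⁻¹ ^ k :=
        ENNReal.tsum_le_tsum fun k => pow_le_pow_left' (inv_prime_le_half hp) k
    _ = 2 := ENNReal.tsum_geometric_two

/-- The total weight of the lists of length `r`. -/
noncomputable def lengthWeight (p r : ℕ) : ℝ≥0∞ :=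
  ∑' v : {l : List ℕ // l.length = r}, listWeight p v

theorem lengthWeight_zero (p : ℕ) : lengthWeight p 0 = 1 := by
  rw [lengthWeight, tsum_eq_single ⟨[], rfl⟩ ?_]
  · exact listWeight_nil p
  · rintro ⟨l, hl⟩ h
    exact absurd (Subtype.ext (List.length_eq_zero_iff.1 hl)) h

theorem tsum_length_succ_le (r : ℕ) (f : List ℕ → ℝ≥0∞) :
    ∑' v : {l : List ℕ // l.length = r + 1}, f v ≤
      ∑' k : ℕ, ∑' v : {l : List ℕ // l.length = r}, f (k :: v) := by
  rw [← ENNReal.tsum_prod (f := fun k (v : {l : List ℕ // l.length = r}) => f (k :: v))]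
  refine ENNReal.tsum_le_tsum_comp_of_surjective
    (f := fun x : ℕ × {l : List ℕ // l.length = r} =>
      (⟨x.1 :: x.2.1, by simp [x.2.2]⟩ : {l : List ℕ // l.length = r + 1}))
    ?_ (fun v => f v)
  rintro ⟨_ | ⟨k, l⟩, hl⟩
  · simp at hl
  · exact ⟨(k, ⟨l, by simpa using hl⟩), rfl⟩

theorem tsum_listWeight_cons_le {p : ℕ} (hp : p.Prime) (k r : ℕ) :
    ∑' v : {l : List ℕ // l.length = r}, listWeight p ((k + 1) :: v) ≤
      (p : ℝ≥0∞)⁻¹ ^ k * (2 * (p : ℝ≥0∞)⁻¹ ^ (r + 1) * lengthWeight p r) := by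
  rw [lengthWeight, ← ENNReal.tsum_mul_left, ← ENNReal.tsum_mul_left]
  refine ENNReal.tsum_le_tsum fun v => (listWeight_cons_le hp k v).trans_eq ?_
  rw [v.2]; ring

theorem lengthWeight_succ_le {p : ℕ} (hp : p.Prime) (r : ℕ) :
    lengthWeight p (r + 1) ≤ 4 * (p : ℝ≥0∞)⁻¹ ^ (r + 1) * lengthWeight p r := by
  refine (tsum_length_succ_le r _).trans ?_
  rw [tsum_eq_zero_add' ENNReal.summable]
  simp only [listWeight_zero_cons, tsum_zero, zero_add]
  calc _ ≤ ∑' k : ℕ, (p : ℝ≥0∞)⁻¹ ^ k *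
        (2 * (p : ℝ≥0∞)⁻¹ ^ (r + 1) * lengthWeight p r) :=
        ENNReal.tsum_le_tsum fun k => tsum_listWeight_cons_le hp k r
    _ ≤ 2 * (2 * (p : ℝ≥0∞)⁻¹ ^ (r + 1) * lengthWeight p r) := by
        rw [ENNReal.tsum_mul_right]; gcongr; exact tsum_inv_prime_pow_le hp
    _ = _ := by ring

theorem four_mul_half_pow_three : (4 : ℝ≥0∞) * 2⁻¹ ^ 3 = 2⁻¹ := by
  have h : (2 : ℝ≥0∞) * 2⁻¹ = 1 := ENNReal.mul_inv_cancel two_ne_zero ENNReal.ofNat_ne_top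
  calc (4 : ℝ≥0∞) * 2⁻¹ ^ 3 = (2 * 2⁻¹) * (2 * 2⁻¹) * 2⁻¹ := by ring
    _ = 2⁻¹ := by rw [h]; simp

theorem lengthWeight_add_two_le {p : ℕ} (hp : p.Prime) (r : ℕ) :
    lengthWeight p (r + 2) ≤ 8 * (p : ℝ≥0∞)⁻¹ ^ 2 * 2⁻¹ ^ r := by
  have hq := inv_prime_le_half hp
  set q := (p : ℝ≥0∞)⁻¹ with hqdef
  have h : (2 : ℝ≥0∞) * 2⁻¹ = 1 := ENNReal.mul_inv_cancel two_ne_zero ENNReal.ofNat_ne_top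
  induction r with
  | zero =>
    calc lengthWeight p 2 ≤ 4 * q ^ 2 * (4 * q ^ 1 * lengthWeight p 0) :=
          (lengthWeight_succ_le hp 1).trans (by gcongr; exact lengthWeight_succ_le hp 0)
      _ = 16 * q ^ 2 * q := by rw [lengthWeight_zero]; ring
      _ ≤ 16 * q ^ 2 * 2⁻¹ := by gcongr
      _ = 8 * q ^ 2 * (2 * 2⁻¹) := by ring
      _ = _ := by rw [h, pow_zero]
  | succ r ih =>
    calc lengthWeight p (r + 1 + 2) ≤ 4 * q ^ (r + 2 + 1) * lengthWeight p (r + 2) :=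
          lengthWeight_succ_le hp (r + 2)
      _ ≤ 4 * 2⁻¹ ^ 3 * lengthWeight p (r + 2) := by
          gcongr 4 * ?_ * _
          calc q ^ (r + 2 + 1) = q ^ r * q ^ 3 := by ring
            _ ≤ 1 * 2⁻¹ ^ 3 := by
              gcongr
              exact pow_le_one₀ zero_le (hq.trans (by simp))
            _ = _ := one_mul _
      _ = 2⁻¹ * lengthWeight p (r + 2) := by rw [four_mul_half_pow_three]
      _ ≤ 2⁻¹ * (8 * q ^ 2 * 2⁻¹ ^ r) := by gcongr
      _ = _ := by ring

/-- The list weight with the trivial list and the list `[1]` removed. -/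
noncomputable def restWeight (p : ℕ) (l : List ℕ) : ℝ≥0∞ :=
  if l = [] ∨ l = [1] then 0 else listWeight p l

theorem restWeight_le (p : ℕ) (l : List ℕ) : restWeight p l ≤ listWeight p l := by
  rw [restWeight]; split_ifs <;> simp

theorem tsum_restWeight_length_one_le {p : ℕ} (hp : p.Prime) :
    ∑' v : {l : List ℕ // l.length = 1}, restWeight p v ≤ 4 * (p : ℝ≥0∞)⁻¹ ^ 2 := by
  refine (tsum_length_succ_le 0 _).trans ?_
  have h1 : ∑' v : {l : List ℕ // l.length = 0}, restWeight p (1 :: v) = 0 := by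
    refine ENNReal.tsum_eq_zero.2 fun v => ?_
    rw [List.length_eq_zero_iff.1 v.2, restWeight, if_pos (Or.inr rfl)]
  have h0 : ∑' v : {l : List ℕ // l.length = 0}, restWeight p (0 :: v) = 0 := by
    refine ENNReal.tsum_eq_zero.2 fun v => ?_
    exact le_antisymm ((restWeight_le p _).trans (listWeight_zero_cons p _).le) zero_le
  rw [tsum_eq_zero_add' ENNReal.summable, tsum_eq_zero_add' ENNReal.summable, zero_add, h0, h1,
    zero_add, zero_add]
  calc _ ≤ ∑' k : ℕ, (p : ℝ≥0∞)⁻¹ ^ (k + 1) *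
        (2 * (p : ℝ≥0∞)⁻¹ ^ (0 + 1) * lengthWeight p 0) :=
        ENNReal.tsum_le_tsum fun k => (ENNReal.tsum_le_tsum fun v => restWeight_le p _).trans
          (tsum_listWeight_cons_le hp (k + 1) 0)
    _ = (∑' k : ℕ, (p : ℝ≥0∞)⁻¹ ^ k) * (2 * (p : ℝ≥0∞)⁻¹ ^ 2) := by
        rw [lengthWeight_zero, ← ENNReal.tsum_mul_right]
        refine tsum_congr fun k => by ring
    _ ≤ 2 * (2 * (p : ℝ≥0∞)⁻¹ ^ 2) := by gcongr; exact tsum_inv_prime_pow_le hp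
    _ = _ := by ring

theorem tsum_restWeight_le {p : ℕ} (hp : p.Prime) :
    ∑' l : List ℕ, restWeight p l ≤ 20 * (p : ℝ≥0∞)⁻¹ ^ 2 := by
  rw [← (Equiv.sigmaFiberEquiv (List.length : List ℕ → ℕ)).tsum_eq, ENNReal.tsum_sigma',
    tsum_eq_zero_add' ENNReal.summable, tsum_eq_zero_add' ENNReal.summable]
  have h0 : ∑' v : {l : List ℕ // l.length = 0}, restWeight p v = 0 := by
    refine ENNReal.tsum_eq_zero.2 fun v => ?_
    rw [List.length_eq_zero_iff.1 v.2, restWeight, if_pos (Or.inl rfl)]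
  have h2 : ∑' r : ℕ, ∑' v : {l : List ℕ // l.length = r + 2}, restWeight p v ≤
      16 * (p : ℝ≥0∞)⁻¹ ^ 2 := by
    calc _ ≤ ∑' r : ℕ, 8 * (p : ℝ≥0∞)⁻¹ ^ 2 * 2⁻¹ ^ r :=
          ENNReal.tsum_le_tsum fun r => (ENNReal.tsum_le_tsum fun v => restWeight_le p _).trans
            (lengthWeight_add_two_le hp r)
      _ ≤ 8 * (p : ℝ≥0∞)⁻¹ ^ 2 * 2 := by
          rw [ENNReal.tsum_mul_left]; gcongr
          exact ENNReal.tsum_geometric_two.le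
      _ = _ := by ring
  calc _ ≤ 0 + (4 * (p : ℝ≥0∞)⁻¹ ^ 2 + 16 * (p : ℝ≥0∞)⁻¹ ^ 2) :=
        add_le_add h0.le (add_le_add (tsum_restWeight_length_one_le hp) h2)
    _ = _ := by ring

theorem partitionsAll_parts_injective :
    Function.Injective (fun lam : PartitionsAll => lam.2.parts) := by
  rintro ⟨n, a⟩ ⟨m, b⟩ h
  have hnm : n = m := by rw [← a.parts_sum, ← b.parts_sum]; exact congrArg Multiset.sum h
  subst hnm
  exact congrArg _ (Nat.Partition.ext h)

theorem partitionsAll_toList_injective :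
    Function.Injective (fun lam : PartitionsAll => lam.2.parts.toList) := by
  intro a b h
  refine partitionsAll_parts_injective ?_
  have := congrArg (fun l : List ℕ => (l : Multiset ℕ)) h
  simpa only [Multiset.coe_toList] using this

theorem toList_partZero : partZero.2.parts.toList = [] := Multiset.toList_zero

theorem toList_partOne : partOne.2.parts.toList = [1] := Multiset.toList_singleton 1

theorem wCL_eq (p : ℕ) (lam : PartitionsAll) :
    wCL p lam = (Nat.card (AddAut (listGroup p lam.2.parts.toList)) : ℝ)⁻¹ := rfl

theorem wCL_partZero (p : ℕ) : wCL p partZero = 1 := by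
  rw [wCL_eq, toList_partZero, card_addAut_nil]; simp

theorem wCL_partOne {p : ℕ} (hp : p.Prime) : wCL p partOne = ((p : ℝ) - 1)⁻¹ := by
  rw [wCL_eq, toList_partOne, card_addAut_singleton hp, Nat.cast_sub hp.one_le, Nat.cast_one]

theorem wCL_nonneg (p : ℕ) (lam : PartitionsAll) : 0 ≤ wCL p lam :=
  inv_nonneg.2 (Nat.cast_nonneg _)

theorem partZero_ne_partOne : partZero ≠ partOne := fun h =>
  zero_ne_one (congrArg Sigma.fst h)

open Classical in
/-- The Cohen–Lenstra weight with the partitions `0` and `1` removed. -/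
noncomputable def restCL (p : ℕ) (lam : PartitionsAll) : ℝ :=
  if lam = partZero ∨ lam = partOne then 0 else wCL p lam

theorem restCL_nonneg (p : ℕ) (lam : PartitionsAll) : 0 ≤ restCL p lam := by
  rw [restCL]; split_ifs
  · exact le_rfl
  · exact wCL_nonneg p lam

theorem ofReal_restCL_le {p : ℕ} (hp : p.Prime) (lam : PartitionsAll) :
    ENNReal.ofReal (restCL p lam) ≤ restWeight p lam.2.parts.toList := by
  have : NeZero p := ⟨hp.ne_zero⟩
  rw [restCL]
  split_ifs with h
  · simp
  · have h' : ¬ (lam.2.parts.toList = [] ∨ lam.2.parts.toList = [1]) := by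
      refine fun hor => h (hor.imp (fun hl => partitionsAll_toList_injective ?_)
        fun hl => partitionsAll_toList_injective ?_)
      · exact hl.trans toList_partZero.symm
      · exact hl.trans toList_partOne.symm
    have hpos : ∀ i ∈ lam.2.parts.toList, 1 ≤ i := fun i hi =>
      lam.2.parts_pos (Multiset.mem_toList.1 hi)
    rw [restWeight, if_neg h', listWeight, if_pos hpos, wCL_eq, ENNReal.ofReal_inv_of_pos,
      ENNReal.ofReal_natCast]
    exact_mod_cast Nat.card_pos

theorem tsum_ofReal_restCL_le {p : ℕ} (hp : p.Prime) :
    ∑' lam, ENNReal.ofReal (restCL p lam) ≤ ENNReal.ofReal (20 / (p : ℝ) ^ 2) := by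
  have hp0 : (0 : ℝ) < p := by exact_mod_cast hp.pos
  calc _ ≤ ∑' lam : PartitionsAll, restWeight p lam.2.parts.toList :=
        ENNReal.tsum_le_tsum (ofReal_restCL_le hp)
    _ ≤ ∑' l : List ℕ, restWeight p l :=
        ENNReal.tsum_comp_le_tsum_of_injective partitionsAll_toList_injective _
    _ ≤ 20 * (p : ℝ≥0∞)⁻¹ ^ 2 := tsum_restWeight_le hp
    _ = _ := by
        rw [div_eq_mul_inv, ← inv_pow, ENNReal.ofReal_mul (by norm_num),
          ENNReal.ofReal_pow (by positivity), ENNReal.ofReal_inv_of_pos hp0,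
          ENNReal.ofReal_natCast, ENNReal.ofReal_ofNat]

theorem summable_restCL {p : ℕ} (hp : p.Prime) : Summable (restCL p) := by
  have h := ENNReal.summable_toReal ((tsum_ofReal_restCL_le hp).trans_lt ENNReal.ofReal_lt_top).ne
  simpa only [ENNReal.toReal_ofReal (restCL_nonneg p _)] using h

theorem tsum_restCL_le {p : ℕ} (hp : p.Prime) : ∑' lam, restCL p lam ≤ 20 / (p : ℝ) ^ 2 := by
  have h := tsum_ofReal_restCL_le hp
  rw [← ENNReal.ofReal_tsum_of_nonneg (restCL_nonneg p) (summable_restCL hp)] at h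
  exact (ENNReal.ofReal_le_ofReal_iff (by positivity)).1 h

open Classical in
theorem exists_tsum_wCL_eq {p : ℕ} (hp : p.Prime) (S : Set PartitionsAll) :
    ∃ e : ℝ, 0 ≤ e ∧ e ≤ 20 / (p : ℝ) ^ 2 ∧ ∑' lam : S, wCL p lam =
      e + (if partZero ∈ S then 1 else 0) + (if partOne ∈ S then ((p : ℝ) - 1)⁻¹ else 0) := by
  have hsum := (summable_restCL hp).indicator S
  refine ⟨∑' lam, S.indicator (restCL p) lam,
    tsum_nonneg fun lam => Set.indicator_nonneg (fun _ _ => restCL_nonneg p _) _,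
    (hsum.tsum_le_tsum (fun lam => Set.indicator_le_self' (fun _ _ => restCL_nonneg p _) lam)
      (summable_restCL hp)).trans (tsum_restCL_le hp), ?_⟩
  rw [tsum_subtype S (wCL p)]
  refine HasSum.tsum_eq ?_
  refine ((hsum.hasSum.add (hasSum_ite_eq partZero (if partZero ∈ S then (1 : ℝ) else 0))).add
    (hasSum_ite_eq partOne (if partOne ∈ S then ((p : ℝ) - 1)⁻¹ else 0))).congr_fun fun lam => ?_
  have h01 := partZero_ne_partOne
  by_cases h0 : lam = partZero
  · subst h0
    simp [Set.indicator, restCL, h01, wCL_partZero]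
  · by_cases h1 : lam = partOne
    · subst h1
      simp [Set.indicator, restCL, h01.symm, wCL_partOne hp]
    · simp [Set.indicator, restCL, h0, h1]

theorem one_sub_sum_le_prod_one_sub {ι : Type*} (s : Finset ι) (f : ι → ℝ)
    (h0 : ∀ i, 0 ≤ f i) (h1 : ∀ i, f i ≤ 1) : 1 - ∑ i ∈ s, f i ≤ ∏ i ∈ s, (1 - f i) := by
  classical
  induction s using Finset.induction_on with
  | empty => simp
  | insert a s ha ih =>
    rw [Finset.sum_insert ha, Finset.prod_insert ha]
    have hs : 0 ≤ ∑ i ∈ s, f i := Finset.sum_nonneg fun i _ => h0 i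
    nlinarith [mul_le_mul_of_nonneg_left ih (sub_nonneg.2 (h1 a)), mul_nonneg (h0 a) hs]

theorem exists_clC_eq {p : ℕ} (hp : p.Prime) :
    ∃ D : ℝ, 1 - 2 / (p : ℝ) ^ 2 ≤ D ∧ D ≤ 1 ∧ clC p = (1 - (p : ℝ)⁻¹) * D := by
  have hp2 : (2 : ℝ) ≤ p := by exact_mod_cast hp.two_le
  set q : ℝ := (p : ℝ)⁻¹ with hq
  have hq0 : 0 ≤ q := by positivity
  have hq2 : q ≤ 1 / 2 := by rw [hq, inv_eq_one_div]; gcongr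
  have hq1 : q < 1 := by linarith
  have hpow1 : ∀ n, q ^ n ≤ 1 := fun n => pow_le_one₀ hq0 hq1.le
  have hs : Summable fun i : ℕ => q ^ (i + 2) :=
    (summable_nat_add_iff 2).2 (summable_geometric_of_lt_one hq0 hq1)
  have hm : Multipliable fun i : ℕ => 1 - q ^ (i + 2) := by
    simpa only [sub_eq_add_neg] using Real.multipliable_one_add_of_summable hs.neg
  have hlim := hm.hasProd.tendsto_prod_nat
  refine ⟨∏' i : ℕ, (1 - q ^ (i + 2)), ?_, ?_, ?_⟩
  · refine ge_of_tendsto' hlim fun n => ?_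
    refine le_trans ?_ (one_sub_sum_le_prod_one_sub _ _ (fun i => by positivity)
      fun i => hpow1 _)
    have h1 : ∑ i ∈ Finset.range n, q ^ (i + 2) ≤ ∑' i : ℕ, q ^ (i + 2) :=
      hs.sum_le_tsum _ fun i _ => by positivity
    have h2 : ∑' i : ℕ, q ^ (i + 2) ≤ 2 / (p : ℝ) ^ 2 := by
      simp_rw [pow_add]
      rw [tsum_mul_right, tsum_geometric_of_lt_one hq0 hq1, div_eq_mul_inv, ← inv_pow, ← hq]
      gcongr
      rw [inv_le_comm₀ (by linarith) two_pos]
      linarith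
    linarith
  · refine le_of_tendsto' hlim fun n => Finset.prod_le_one (fun i _ => ?_) fun i _ => ?_
    · linarith [hpow1 (i + 2)]
    · have : 0 ≤ q ^ (i + 2) := by positivity
      linarith
  · rw [clC, tprod_eq_zero_mul' (f := fun i : ℕ => 1 - q ^ (i + 1)) hm]
    simp

theorem Pp_nonneg {p : ℕ} (hp : p.Prime) (S : Set PartitionsAll) : 0 ≤ Pp p S := by
  obtain ⟨D, hD, -, hC⟩ := exists_clC_eq hp
  have hp2 : (2 : ℝ) ≤ p := by exact_mod_cast hp.two_le
  refine mul_nonneg (tsum_nonneg fun lam => wCL_nonneg p lam) ?_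
  rw [hC]
  refine mul_nonneg (sub_nonneg.2 (inv_le_one_of_one_le₀ (by linarith))) (le_trans ?_ hD)
  rw [sub_nonneg, div_le_one (by positivity)]
  nlinarith

/-- The local probability of a set containing `0` and `1` is close to `1`. -/
theorem Pp_near_one {p : ℕ} (hp : p.Prime) {S : Set PartitionsAll} (h0 : partZero ∈ S)
    (h1 : partOne ∈ S) : 0 < Pp p S ∧ |Pp p S - 1| ≤ 22 / (p : ℝ) ^ 2 := by
  obtain ⟨D, hD, hD1, hC⟩ := exists_clC_eq hp
  obtain ⟨e, he0, he, hs⟩ := exists_tsum_wCL_eq hp S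
  have hp2 : (2 : ℝ) ≤ p := by exact_mod_cast hp.two_le
  rw [if_pos h0, if_pos h1] at hs
  have hPp : Pp p S = D * (1 + (1 - (p : ℝ)⁻¹) * e) := by
    rw [Pp, hs, hC]
    have : (p : ℝ) - 1 ≠ 0 := by linarith
    field_simp
    ring
  have ha0 : 0 ≤ 1 - (p : ℝ)⁻¹ := sub_nonneg.2 (inv_le_one_of_one_le₀ (by linarith))
  have ha1 : 1 - (p : ℝ)⁻¹ ≤ 1 := by simp
  set f := (1 - (p : ℝ)⁻¹) * e with hf
  have hf0 : 0 ≤ f := mul_nonneg ha0 he0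
  have hfe : f ≤ 20 / (p : ℝ) ^ 2 := (mul_le_of_le_one_left he0 ha1).trans he
  have hDpos : 0 < D := by
    refine lt_of_lt_of_le ?_ hD
    rw [sub_pos, div_lt_one (by positivity)]
    nlinarith
  have e1 : (22 : ℝ) / (p : ℝ) ^ 2 = 20 / (p : ℝ) ^ 2 + 2 / (p : ℝ) ^ 2 := by ring
  have h2 : 0 ≤ 2 / (p : ℝ) ^ 2 := by positivity
  rw [hPp]
  refine ⟨by positivity, abs_le.2 ⟨?_, ?_⟩⟩
  · nlinarith [mul_nonneg hDpos.le hf0]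
  · nlinarith [mul_nonneg (sub_nonneg.2 hD1) hf0]

/-- The local probability of a set missing `0` or `1` has a defect of order `1 / p`. -/
theorem Pp_le_exp {p : ℕ} (hp : p.Prime) {S : Set PartitionsAll}
    (h : ¬ (partZero ∈ S ∧ partOne ∈ S)) :
    Pp p S ≤ Real.exp (-(1 / (p : ℝ)) + 506 / (p : ℝ) ^ 2) := by
  obtain ⟨D, hD, hD1, hC⟩ := exists_clC_eq hp
  obtain ⟨e, he0, he, hs⟩ := exists_tsum_wCL_eq hp S
  have hp2 : (2 : ℝ) ≤ p := by exact_mod_cast hp.two_le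
  set q := 1 / (p : ℝ) with hq
  have hq0 : 0 < q := by positivity
  have hq2 : q ≤ 1 / 2 := by rw [hq]; gcongr
  have hinv : (p : ℝ)⁻¹ = q := by rw [hq, one_div]
  have hc : ∀ c : ℝ, c / (p : ℝ) ^ 2 = c * q ^ 2 := fun c => by rw [hq]; field_simp
  rw [hc] at he ⊢
  rw [hinv] at hC
  set s := ∑' lam : S, wCL p lam with hsdef
  have hs0 : 0 ≤ s := tsum_nonneg fun lam => wCL_nonneg p lam
  have hle : Pp p S ≤ s * (1 - q) := by
    rw [Pp, hC, ← hsdef]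
    exact mul_le_mul_of_nonneg_left (mul_le_of_le_one_right (by linarith) hD1) hs0
  refine hle.trans ?_
  by_cases h0 : partZero ∈ S
  · have h1 : partOne ∉ S := fun h1 => h ⟨h0, h1⟩
    rw [if_pos h0, if_neg h1] at hs
    rw [Real.exp_add]
    calc s * (1 - q) ≤ (20 * q ^ 2 + 1) * (1 - q) := by
          gcongr
          · linarith
          · linarith
      _ ≤ Real.exp (506 * q ^ 2) * Real.exp (-q) := by
          gcongr
          · linarith
          · nlinarith [Real.add_one_le_exp (506 * q ^ 2), sq_nonneg q]
          · linarith [Real.add_one_le_exp (-q)]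
      _ = _ := mul_comm _ _
  · have hs' : s ≤ 20 * q ^ 2 + 2 * q := by
      have h3 : ((p : ℝ) - 1)⁻¹ ≤ 2 * q := by
        rw [hq, mul_one_div, inv_le_comm₀ (by linarith) (by positivity), inv_div]
        linarith
      rw [if_neg h0] at hs
      split_ifs at hs <;> linarith
    have h4 : s * (1 - q) ≤ 22 * q := by nlinarith
    refine h4.trans (le_trans ?_ (Real.add_one_le_exp _))
    nlinarith [sq_nonneg (23 * q - 1 / 2)]

theorem globPartial_eq (S : Set PartitionsAll) (x : ℕ) :
    globPartial S x = ∏ n ∈ Finset.range (x + 1), if n.Prime then Pp n S else 1 := by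
  rw [globPartial, primesUpTo, Nat.primesBelow, Finset.prod_filter]

theorem summable_const_div_sq (c : ℝ) : Summable fun n : ℕ => c / (n : ℝ) ^ 2 := by
  simpa only [mul_one_div] using
    (Real.summable_one_div_nat_pow.2 one_lt_two).mul_left c

theorem exists_tendsto_globPartial {S : Set PartitionsAll} (h0 : partZero ∈ S)
    (h1 : partOne ∈ S) : ∃ L : ℝ, Tendsto (globPartial S) atTop (𝓝 L) ∧ 0 < L := by
  let f : ℕ → ℝ := fun n => if n.Prime then Pp n S else 1
  have hfpos : ∀ n, 0 < f n := fun n => by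
    simp only [f]
    split_ifs with hn
    · exact (Pp_near_one hn h0 h1).1
    · exact one_pos
  have hsum : Summable fun n => f n - 1 := by
    refine Summable.of_norm_bounded (summable_const_div_sq 22) fun n => ?_
    simp only [f]
    split_ifs with hn
    · exact (Pp_near_one hn h0 h1).2
    · simpa using (by positivity : (0 : ℝ) ≤ 22 / (n : ℝ) ^ 2)
  have hlog : Summable fun n => Real.log (f n) := by
    simpa using Real.summable_log_one_add_of_summable hsum
  refine ⟨Real.exp (∑' n, Real.log (f n)), ?_, Real.exp_pos _⟩
  have h := (Real.hasProd_of_hasSum_log hfpos hlog.hasSum).tendsto_prod_nat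
  have h' := h.comp (tendsto_add_atTop_nat 1)
  exact h'.congr fun x => (globPartial_eq S x).symm

theorem tendsto_globPartial_zero {S : Set PartitionsAll}
    (h : ¬ (partZero ∈ S ∧ partOne ∈ S)) : Tendsto (globPartial S) atTop (𝓝 0) := by
  let g : ℕ → ℝ := Set.indicator {p | p.Prime} fun n : ℕ => (1 : ℝ) / n
  have hg0 : ∀ n, 0 ≤ g n := fun n => Set.indicator_nonneg (fun n _ => by positivity) n
  have hg : Tendsto (fun n => ∑ i ∈ Finset.range n, g i) atTop atTop :=
    (not_summable_iff_tendsto_nat_atTop_of_nonneg hg0).1 not_summable_one_div_on_primes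
  have hc := summable_const_div_sq 506
  set c := ∑' n : ℕ, 506 / (n : ℝ) ^ 2
  have hbound : Tendsto (fun x : ℕ => Real.exp (-(∑ i ∈ Finset.range (x + 1), g i) + c))
      atTop (𝓝 0) := by
    refine Real.tendsto_exp_atBot.comp (tendsto_atBot_add_const_right _ _ ?_)
    exact tendsto_neg_atTop_atBot.comp (hg.comp (tendsto_add_atTop_nat 1))
  refine squeeze_zero (fun x => ?_) (fun x => ?_) hbound
  · rw [globPartial_eq]
    refine Finset.prod_nonneg fun n _ => ?_
    split_ifs with hn
    · exact Pp_nonneg hn S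
    · exact zero_le_one
  · rw [globPartial_eq]
    calc _ ≤ ∏ n ∈ Finset.range (x + 1), Real.exp (-g n + 506 / (n : ℝ) ^ 2) := by
          refine Finset.prod_le_prod (fun n _ => ?_) fun n _ => ?_
          · split_ifs with hn
            · exact Pp_nonneg hn S
            · exact zero_le_one
          · split_ifs with hn
            · have : g n = 1 / n := Set.indicator_of_mem (by exact hn) _
              rw [this]
              exact Pp_le_exp hn h
            · have : g n = 0 := Set.indicator_of_notMem (by exact hn) _
              rw [this]
              exact Real.one_le_exp (by positivity)
      _ = Real.exp (-(∑ n ∈ Finset.range (x + 1), g n) +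
            ∑ n ∈ Finset.range (x + 1), 506 / (n : ℝ) ^ 2) := by
          rw [← Real.exp_sum, Finset.sum_add_distrib, Finset.sum_neg_distrib]
      _ ≤ _ := by
          gcongr
          exact hc.sum_le_tsum _ fun n _ => by positivity

/-- `lim_{x→∞} ∏_{p ≤ x} P_p(S) > 0` if and only if both the empty partition and the
unique partition of `1` belong to `S`. -/
theorem glob_pos_iff (S : Set PartitionsAll) :
    (∃ L : ℝ, Filter.Tendsto (globPartial S) Filter.atTop (nhds L) ∧ 0 < L) ↔
      (partZero ∈ S ∧ partOne ∈ S) := by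
  refine ⟨fun ⟨L, hL, hpos⟩ => ?_, fun ⟨h0, h1⟩ => exists_tendsto_globPartial h0 h1⟩
  by_contra h
  exact hpos.ne' (tendsto_nhds_unique hL (tendsto_globPartial_zero h))
end

section
/- Let D₀, D₁, …, D_n ∈ 𝔇 be such that D₁, …, D_n are mutually disjoint and ⋃_{i=1}^n D_i ⊆ D₀. Then ∑_{i=1}^n P(D_i) ≤ P(D₀). In particular, P is monotone on 𝔇: if D₁ ⊆ D₀ with D₀, D₁ ∈ 𝔇, then P(D₁) ≤ P(D₀). -/
open Filter Topology

open scoped ENNReal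

theorem card_addAut_inv_mul_generating_le {G : Type*} [AddCommGroup G] [Finite G] (n : ℕ) :
    (Nat.card {v : Fin n → G // Function.Surjective (Fintype.linearCombination ℤ v)} : ℝ≥0∞) *
        ((Nat.card (AddAut G) : ℝ≥0∞)⁻¹ * ((Nat.card G : ℝ≥0∞)⁻¹) ^ n) ≤
      ∑' H : {H : AddSubgroup (Fin n → ℤ) // Nonempty ((Fin n → ℤ) ⧸ H ≃+ G)},
        ((H.1.index : ℝ≥0∞)⁻¹) ^ n := by
  let V := {v : Fin n → G // Function.Surjective (Fintype.linearCombination ℤ v)}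
  let T := {H : AddSubgroup (Fin n → ℤ) // Nonempty ((Fin n → ℤ) ⧸ H ≃+ G)}
  have : Finite (AddAut G) := DFunLike.finite _
  let φ (v : V) : (Fin n → ℤ) →+ G := (Fintype.linearCombination ℤ v.1).toAddMonoidHom
  let ε (v : V) : (Fin n → ℤ) ⧸ (φ v).ker ≃+ G :=
    QuotientAddGroup.quotientKerEquivOfSurjective (φ v) v.2
  let τ (v : V) : T := ⟨(φ v).ker, ⟨ε v⟩⟩
  let f (v : V) : T × AddAut G := (τ v, (τ v).2.some.symm.trans (ε v))
  have hφ (v : V) (x : Fin n → ℤ) : φ v x = (f v).2 ((f v).1.2.some (QuotientAddGroup.mk x)) := by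
    change _ = ε v ((τ v).2.some.symm ((τ v).2.some (QuotientAddGroup.mk x)))
    rw [AddEquiv.symm_apply_apply]
    rfl
  have hf : Function.Injective f := by
    intro v w h
    apply Subtype.ext
    funext i
    have h1 : φ v (Pi.single i 1) = φ w (Pi.single i 1) := by rw [hφ, hφ, h]
    simpa [φ] using h1
  have hindex (H : T) : H.1.index = Nat.card G := Nat.card_congr H.2.some.toEquiv
  calc _ = ∑' _ : V, ((Nat.card (AddAut G) : ℝ≥0∞)⁻¹ * ((Nat.card G : ℝ≥0∞)⁻¹) ^ n) := by
        rw [ENNReal.tsum_const, ENat.card_eq_coe_natCard, ENat.toENNReal_coe]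
    _ ≤ ∑' _ : T × AddAut G, ((Nat.card (AddAut G) : ℝ≥0∞)⁻¹ * ((Nat.card G : ℝ≥0∞)⁻¹) ^ n) :=
        ENNReal.tsum_comp_le_tsum_of_injective hf _
    _ = _ := by
        rw [ENNReal.tsum_prod']
        refine tsum_congr fun H => ?_
        rw [ENNReal.tsum_const, ENat.card_eq_coe_natCard, ENat.toENNReal_coe, hindex, ← mul_assoc,
          ENNReal.mul_inv_cancel (by exact_mod_cast Nat.card_pos.ne') (by simp), one_mul]

theorem tendsto_card_generating_div {G : Type*} [AddCommGroup G] [Finite G] :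
    Tendsto (fun n : ℕ =>
      (Nat.card {v : Fin n → G // Function.Surjective (Fintype.linearCombination ℤ v)} : ℝ) *
        ((Nat.card G : ℝ)⁻¹) ^ n) atTop (𝓝 1) := by
  classical
  have : Fintype G := Fintype.ofFinite G
  have : Fintype (Submodule ℤ G) := Fintype.ofFinite _
  have hG : (0 : ℝ) < Nat.card G := by exact_mod_cast Nat.card_pos
  have hlow (n : ℕ) : 1 - ∑ M : {M : Submodule ℤ G // M ≠ ⊤},
      ((Nat.card M.1 : ℝ) / Nat.card G) ^ n ≤
      (Nat.card {v : Fin n → G // Function.Surjective (Fintype.linearCombination ℤ v)} : ℝ) *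
        ((Nat.card G : ℝ)⁻¹) ^ n := by
    have hcount : Nat.card G ^ n ≤
        Nat.card {v : Fin n → G // Function.Surjective (Fintype.linearCombination ℤ v)} +
        ∑ M : {M : Submodule ℤ G // M ≠ ⊤}, Nat.card M.1 ^ n := by
      have hsurj : Function.Surjective (fun t :
          {v : Fin n → G // Function.Surjective (Fintype.linearCombination ℤ v)} ⊕
            (Σ M : {M : Submodule ℤ G // M ≠ ⊤}, Fin n → M.1) =>
          (Sum.elim Subtype.val (fun t i => (t.2 i : G)) t : Fin n → G)) := by
        intro v
        by_cases hv : Function.Surjective (Fintype.linearCombination ℤ v)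
        · exact ⟨Sum.inl ⟨v, hv⟩, rfl⟩
        · refine ⟨Sum.inr ⟨⟨LinearMap.range (Fintype.linearCombination ℤ v),
            fun h => hv (LinearMap.range_eq_top.1 h)⟩, fun i => ⟨v i, Pi.single i 1, by simp⟩⟩, rfl⟩
      have := Nat.card_le_card_of_surjective _ hsurj
      simpa [Nat.card_sum, Nat.card_sigma, Nat.card_fun] using this
    have hcount' : (Nat.card G : ℝ) ^ n ≤
        Nat.card {v : Fin n → G // Function.Surjective (Fintype.linearCombination ℤ v)} +
        ∑ M : {M : Submodule ℤ G // M ≠ ⊤}, (Nat.card M.1 : ℝ) ^ n := by exact_mod_cast hcount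
    simp_rw [div_pow]
    rw [← Finset.sum_div, inv_pow, ← div_eq_mul_inv, sub_le_iff_le_add, ← add_div,
      le_div_iff₀ (pow_pos hG n), one_mul]
    exact hcount'
  have hup (n : ℕ) :
      (Nat.card {v : Fin n → G // Function.Surjective (Fintype.linearCombination ℤ v)} : ℝ) *
        ((Nat.card G : ℝ)⁻¹) ^ n ≤ 1 := by
    rw [inv_pow, ← div_eq_mul_inv, div_le_one (pow_pos hG n)]
    have := Nat.card_le_card_of_injective
      (Subtype.val : {v : Fin n → G // Function.Surjective (Fintype.linearCombination ℤ v)} → _)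
      Subtype.val_injective
    rw [Nat.card_fun, Nat.card_fin] at this
    exact_mod_cast this
  refine tendsto_of_tendsto_of_tendsto_of_le_of_le ?_ tendsto_const_nhds hlow hup
  have hsum : Tendsto (fun n : ℕ => ∑ M : {M : Submodule ℤ G // M ≠ ⊤},
      ((Nat.card M.1 : ℝ) / Nat.card G) ^ n) atTop (𝓝 (∑ M : {M : Submodule ℤ G // M ≠ ⊤}, 0)) := by
    refine tendsto_finsetSum _ fun M _ => tendsto_pow_atTop_nhds_zero_of_lt_one (by positivity) ?_
    rw [div_lt_one hG]
    have hlt : Nat.card M.1 < Nat.card G := by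
      refine lt_of_le_of_ne (Nat.card_le_card_of_injective _ M.1.injective_subtype) fun h => M.2 ?_
      have := (M.1.injective_subtype.bijective_of_nat_card_le h.ge).2
      rwa [← LinearMap.range_eq_top, Submodule.range_subtype] at this
    exact_mod_cast hlt
  simpa using (tendsto_const_nhds (x := (1 : ℝ))).sub hsum

theorem card_pGroup_pow_torsion {p : ℕ} (hp : p.Prime) (lam : PartitionsAll) (k : ℕ) :
    Nat.card {x : pGroup p lam // p ^ k • x = 0} =
      p ^ (lam.2.parts.map fun a => min a k).sum := by
  have hcyc (a : ℕ) : Nat.card {x : ZMod (p ^ a) // p ^ k • x = 0} = p ^ min a k := by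
    have : NeZero (p ^ a) := ⟨pow_ne_zero _ hp.ne_zero⟩
    have := IsAddCyclic.card_nsmulAddMonoidHom_ker (ZMod (p ^ a)) (p ^ k)
    rw [Nat.card_zmod] at this
    have hg : (p ^ a).gcd (p ^ k) = p ^ min a k := by
      rcases le_total a k with h | h
      · rw [min_eq_left h, Nat.gcd_eq_left (pow_dvd_pow p h)]
      · rw [min_eq_right h, Nat.gcd_eq_right (pow_dvd_pow p h)]
    rw [← hg, ← this]
    rfl
  let e : {x : pGroup p lam // p ^ k • x = 0} ≃
      ∀ i, {x : ZMod (p ^ lam.2.parts.toList.get i) // p ^ k • x = 0} :=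
    (Equiv.subtypeEquivRight fun x => by simp [funext_iff]).trans Equiv.subtypePiEquivPi
  rw [Nat.card_congr e, Nat.card_pi]
  simp_rw [hcyc]
  rw [Finset.prod_pow_eq_pow_sum]
  congr 1
  conv_rhs => rw [← lam.2.parts.coe_toList]
  rw [Multiset.map_coe, Multiset.sum_coe, ← Fin.sum_univ_fun_getElem]
  rfl

theorem card_pGroup {p : ℕ} (lam : PartitionsAll) : Nat.card (pGroup p lam) = p ^ lam.1 := by
  rw [Nat.card_pi]
  simp_rw [Nat.card_zmod]
  rw [Finset.prod_pow_eq_pow_sum]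
  congr 1
  refine Eq.trans ?_ lam.2.parts_sum
  conv_rhs => rw [← lam.2.parts.coe_toList]
  rw [Multiset.sum_coe]
  exact Fin.sum_univ_getElem _

theorem multiset_eq_of_sum_map_min_eq {s t : Multiset ℕ} (hs : ∀ a ∈ s, 0 < a)
    (ht : ∀ a ∈ t, 0 < a)
    (h : ∀ k, (s.map fun a => min a k).sum = (t.map fun a => min a k).sum) : s = t := by
  have hcount (u : Multiset ℕ) (k : ℕ) :
      2 * (u.map fun a => min a (k + 1)).sum =
        (u.map fun a => min a k).sum + (u.map fun a => min a (k + 2)).sum + u.count (k + 1) := by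
    induction u using Multiset.induction with
    | empty => simp
    | cons a u ih =>
      simp only [Multiset.map_cons, Multiset.sum_cons, Multiset.count_cons]
      split_ifs <;> omega
  ext k
  cases k with
  | zero =>
    rw [Multiset.count_eq_zero_of_notMem fun h0 => (hs 0 h0).false,
      Multiset.count_eq_zero_of_notMem fun h0 => (ht 0 h0).false]
  | succ k =>
    have h1 := hcount s k
    have h2 := hcount t k
    rw [h, h, h] at h1
    omega

theorem eq_of_pGroup_addEquiv {p : ℕ} (hp : p.Prime) {lam mu : PartitionsAll}
    (e : pGroup p lam ≃+ pGroup p mu) : lam = mu := by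
  have hparts : lam.2.parts = mu.2.parts := by
    refine multiset_eq_of_sum_map_min_eq (fun a => lam.2.parts_pos) (fun a => mu.2.parts_pos)
      fun k => Nat.pow_right_injective hp.two_le ?_
    dsimp only
    rw [← card_pGroup_pow_torsion hp, ← card_pGroup_pow_torsion hp]
    refine Nat.card_congr (e.toEquiv.subtypeEquiv fun x => ?_)
    change _ ↔ p ^ k • e x = 0
    rw [← map_nsmul, map_eq_zero_iff e e.injective]
  obtain ⟨a, s⟩ := lam
  obtain ⟨b, t⟩ := mu
  have hab : a = b := by rw [← s.parts_sum, ← t.parts_sum, hparts]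
  subst hab
  exact congrArg (Sigma.mk a) (Nat.Partition.ext hparts)

/-- The local factor at `p` of the subgroup zeta function of `A`, evaluated at `s`. -/
noncomputable def subgroupZeta (p : ℕ) (A : Type*) [AddCommGroup A] (s : ℕ) : ℝ≥0∞ :=
  ∑' H : {H : AddSubgroup A // ∃ k, H.index = p ^ k}, ((H.1.index : ℝ≥0∞)⁻¹) ^ s

theorem subgroupZeta_le_of_addEquiv (p : ℕ) {A B : Type*} [AddCommGroup A] [AddCommGroup B]
    (e : A ≃+ B) (s : ℕ) : subgroupZeta p A s ≤ subgroupZeta p B s := by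
  have hidx (H : AddSubgroup A) : (H.comap e.symm.toAddMonoidHom).index = H.index :=
    H.index_comap_of_surjective e.symm.surjective
  let f : {H : AddSubgroup A // ∃ k, H.index = p ^ k} →
      {H : AddSubgroup B // ∃ k, H.index = p ^ k} := fun H =>
    ⟨H.1.comap e.symm.toAddMonoidHom, by rw [hidx]; exact H.2⟩
  have hf : Function.Injective f := fun H K h =>
    Subtype.ext (AddSubgroup.comap_injective e.symm.surjective (congrArg Subtype.val h))
  calc subgroupZeta p A s = ∑' H, (((f H).1.index : ℝ≥0∞)⁻¹) ^ s := by
        simp only [subgroupZeta, f, hidx]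
    _ ≤ _ := ENNReal.tsum_comp_le_tsum_of_injective hf _

theorem index_comap_inl_mul_index_map_snd {A B : Type*} [AddCommGroup A] [AddCommGroup B]
    (H : AddSubgroup (A × B)) :
    (H.comap (AddMonoidHom.inl A B)).index * (H.map (AddMonoidHom.snd A B)).index = H.index := by
  rw [AddSubgroup.index_comap, AddSubgroup.index_map _ (AddMonoidHom.snd A B),
    (AddMonoidHom.snd A B).range_eq_top.2 Prod.snd_surjective, AddSubgroup.index_top, mul_one]
  have : (AddMonoidHom.inl A B).range = (AddMonoidHom.snd A B).ker := by
    ext x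
    refine ⟨?_, fun h => ⟨x.1, Prod.ext rfl (Eq.symm h)⟩⟩
    rintro ⟨a, rfl⟩
    rfl
  rw [this, ← AddSubgroup.relIndex_sup_left]
  exact AddSubgroup.relIndex_mul_index le_sup_left

theorem exists_split_of_index_eq_pow {p : ℕ} (hp : p.Prime) {A : Type*} [AddCommGroup A]
    (H : {H : AddSubgroup (A × ℤ) // ∃ k, H.index = p ^ k}) :
    ∃ (a : ℕ) (K : {K : AddSubgroup A // ∃ k, K.index = p ^ k}) (x : A),
      H.1.index = K.1.index * p ^ a ∧
      ∀ y : A × ℤ, y ∈ H.1 ↔ ∃ m : ℤ, y.2 = m * p ^ a ∧ y.1 - m • x ∈ K.1 := by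
  obtain ⟨H, k, hk⟩ := H
  have hmul := index_comap_inl_mul_index_map_snd H
  obtain ⟨b, -, hb⟩ := (Nat.dvd_prime_pow hp).1 (hk ▸ Dvd.intro _ hmul)
  obtain ⟨a, -, ha⟩ := (Nat.dvd_prime_pow hp).1 (hk ▸ Dvd.intro_left _ hmul)
  have hmap : H.map (AddMonoidHom.snd A ℤ) = AddSubgroup.zmultiples ((p : ℤ) ^ a) := by
    obtain ⟨g, hg⟩ := Int.subgroup_cyclic (H.map (AddMonoidHom.snd A ℤ))
    rw [← AddSubgroup.zmultiples_eq_closure] at hg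
    rw [hg, Int.index_zmultiples] at ha
    rw [hg, ← Int.zmultiples_natAbs, ha]
    simp
  have hx : (p : ℤ) ^ a ∈ H.map (AddMonoidHom.snd A ℤ) := hmap ▸ AddSubgroup.mem_zmultiples _
  obtain ⟨⟨x, t⟩, hxH, ht⟩ := hx
  obtain rfl : t = (p : ℤ) ^ a := ht
  have key (m : ℤ) (y : A × ℤ) (hy : y.2 = m * p ^ a) :
      y ∈ H ↔ y.1 - m • x ∈ H.comap (AddMonoidHom.inl A ℤ) := by
    have : y = AddMonoidHom.inl A ℤ (y.1 - m • x) + m • (x, (p : ℤ) ^ a) := by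
      ext <;> simp [hy]
    rw [AddSubgroup.mem_comap]
    conv_lhs => rw [this]
    exact AddSubgroup.add_mem_cancel_right _ (H.zsmul_mem hxH m)
  refine ⟨a, ⟨_, b, hb⟩, x, by rw [← hmul, ha], fun y => ⟨fun hy => ?_, ?_⟩⟩
  · have : y.2 ∈ H.map (AddMonoidHom.snd A ℤ) := ⟨y, hy, rfl⟩
    rw [hmap, AddSubgroup.mem_zmultiples_iff] at this
    obtain ⟨m, hm⟩ := this
    have hm' : y.2 = m * p ^ a := by rw [← hm, smul_eq_mul]
    exact ⟨m, hm', (key m y hm').1 hy⟩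
  · rintro ⟨m, hm, hy⟩
    exact (key m y hm).2 hy

theorem subgroupZeta_prod_int_le {p : ℕ} (hp : p.Prime) (A : Type*) [AddCommGroup A] (s : ℕ) :
    subgroupZeta p (A × ℤ) (s + 1) ≤ (1 - (p : ℝ≥0∞)⁻¹ ^ (s + 1))⁻¹ * subgroupZeta p A s := by
  choose a K x hidx hmem using exists_split_of_index_eq_pow hp (A := A)
  let f : {H : AddSubgroup (A × ℤ) // ∃ k, H.index = p ^ k} →
      ℕ × Σ K : {K : AddSubgroup A // ∃ k, K.index = p ^ k}, A ⧸ K.1 :=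
    fun H => (a H, ⟨K H, QuotientAddGroup.mk (x H)⟩)
  have hf : Function.Injective f := by
    intro H H' h
    have h1 : a H = a H' := congrArg Prod.fst h
    have h2 : K H = K H' := congrArg (fun t => t.2.1) h
    have h3 : x H - x H' ∈ (K H).1 := by
      have := congrArg Prod.snd h
      simp only [f] at this
      generalize K H = K₁ at this h2 ⊢
      subst h2
      rw [Sigma.mk.injEq] at this
      rw [sub_eq_add_neg, add_comm, ← QuotientAddGroup.eq]
      exact (eq_of_heq this.2).symm
    apply Subtype.ext
    ext y
    rw [hmem, hmem, ← h1, ← h2]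
    refine exists_congr fun m => and_congr_right fun _ => ?_
    have : y.1 - m • x H' = y.1 - m • x H + m • (x H - x H') := by
      rw [smul_sub]; abel
    rw [this, AddSubgroup.add_mem_cancel_right _ ((K H).1.zsmul_mem h3 m)]
  calc subgroupZeta p (A × ℤ) (s + 1)
      = ∑' H, (((f H).2.1.1.index : ℝ≥0∞)⁻¹ * ((p : ℝ≥0∞)⁻¹) ^ (f H).1) ^ (s + 1) := by
        refine tsum_congr fun H => ?_
        rw [hidx]
        push_cast
        rw [ENNReal.mul_inv (by simp) (by simp), ENNReal.inv_pow]
    _ ≤ ∑' t : ℕ × Σ K : {K : AddSubgroup A // ∃ k, K.index = p ^ k}, A ⧸ K.1,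
          ((t.2.1.1.index : ℝ≥0∞)⁻¹ * ((p : ℝ≥0∞)⁻¹) ^ t.1) ^ (s + 1) :=
        ENNReal.tsum_comp_le_tsum_of_injective hf _
    _ = ∑' n : ℕ, ((p : ℝ≥0∞)⁻¹ ^ (s + 1)) ^ n * subgroupZeta p A s := by
        rw [ENNReal.tsum_prod']
        refine tsum_congr fun n => ?_
        rw [ENNReal.tsum_sigma', subgroupZeta, ← ENNReal.tsum_mul_left]
        refine tsum_congr fun K => ?_
        have h0 : K.1.index ≠ 0 := by
          obtain ⟨k, hk⟩ := K.2
          exact hk ▸ pow_ne_zero _ hp.ne_zero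
        have : Finite (A ⧸ K.1) := Nat.finite_of_card_ne_zero h0
        dsimp only
        rw [ENNReal.tsum_const, ENat.card_eq_coe_natCard, ← AddSubgroup.index_eq_card]
        simp only [ENat.toENNReal_coe]
        rw [mul_pow, pow_succ]
        calc _ = ((K.1.index : ℝ≥0∞) * (K.1.index : ℝ≥0∞)⁻¹) *
              ((K.1.index : ℝ≥0∞)⁻¹ ^ s * ((p : ℝ≥0∞)⁻¹ ^ n) ^ (s + 1)) := by ring
          _ = _ := by
            rw [ENNReal.mul_inv_cancel (by exact_mod_cast h0) (by simp), one_mul, mul_comm]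
            ring
    _ = _ := by rw [ENNReal.tsum_mul_right, ENNReal.tsum_geometric]

theorem subgroupZeta_int_pow_le {p : ℕ} (hp : p.Prime) (n : ℕ) :
    subgroupZeta p (Fin n → ℤ) n ≤ (∏ i ∈ Finset.range n, (1 - (p : ℝ≥0∞)⁻¹ ^ (i + 1)))⁻¹ := by
  induction n with
  | zero =>
    simp only [subgroupZeta, pow_zero, Finset.range_zero, Finset.prod_empty, inv_one]
    rw [ENNReal.tsum_const, mul_one]
    have : ENat.card {H : AddSubgroup (Fin 0 → ℤ) // ∃ k, H.index = p ^ k} ≤ 1 :=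
      ENat.card_le_one_iff_subsingleton _ |>.2 inferInstance
    exact_mod_cast this
  | succ n ih =>
    let e : (Fin (n + 1) → ℤ) ≃+ (Fin n → ℤ) × ℤ :=
      (Fin.consLinearEquiv ℤ (fun _ : Fin (n + 1) => ℤ)).symm.toAddEquiv.trans AddEquiv.prodComm
    refine (subgroupZeta_le_of_addEquiv p e _).trans
      ((subgroupZeta_prod_int_le hp _ n).trans ?_)
    rw [Finset.prod_range_succ, ENNReal.mul_inv, mul_comm]
    · gcongr
    · right; simp
    · left
      exact ENNReal.prod_ne_top fun i _ => by simp

theorem sum_wCL_generating_le {p : ℕ} (hp : p.Prime) (L : Finset PartitionsAll) (n : ℕ) :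
    ∑ lam ∈ L, (Nat.card {v : Fin n → pGroup p lam //
        Function.Surjective (Fintype.linearCombination ℤ v)} : ℝ≥0∞) *
        ((Nat.card (AddAut (pGroup p lam)) : ℝ≥0∞)⁻¹ *
          ((Nat.card (pGroup p lam) : ℝ≥0∞)⁻¹) ^ n) ≤
      subgroupZeta p (Fin n → ℤ) n := by
  have : NeZero p := ⟨hp.ne_zero⟩
  let f (t : Σ lam : L, {H : AddSubgroup (Fin n → ℤ) //
      Nonempty ((Fin n → ℤ) ⧸ H ≃+ pGroup p lam)}) :
      {H : AddSubgroup (Fin n → ℤ) // ∃ k, H.index = p ^ k} :=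
    ⟨t.2.1, t.1.1.1, (Nat.card_congr t.2.2.some.toEquiv).trans (card_pGroup t.1.1)⟩
  have hf : Function.Injective f := by
    rintro ⟨⟨lam, hlam⟩, H, hH⟩ ⟨⟨mu, hmu⟩, K, hK⟩ h
    obtain rfl : H = K := congrArg Subtype.val h
    obtain rfl : lam = mu := eq_of_pGroup_addEquiv hp (hH.some.symm.trans hK.some)
    rfl
  rw [← Finset.sum_coe_sort]
  refine (Finset.sum_le_sum fun lam _ => card_addAut_inv_mul_generating_le n).trans ?_
  rw [← tsum_fintype (L := SummationFilter.unconditional _)]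
  refine (ENNReal.tsum_sigma' fun t => (((f t).1.index : ℝ≥0∞)⁻¹) ^ n).ge.trans ?_
  exact ENNReal.tsum_comp_le_tsum_of_injective hf (fun H => ((H.1.index : ℝ≥0∞)⁻¹) ^ n)

theorem tendsto_prod_clC {p : ℕ} (hp : p.Prime) :
    Tendsto (fun n => ∏ i ∈ Finset.range n, (1 - ((p : ℝ))⁻¹ ^ (i + 1))) atTop (𝓝 (clC p)) := by
  have hq : (p : ℝ)⁻¹ < 1 := inv_lt_one_of_one_lt₀ (by exact_mod_cast hp.one_lt)
  have hs : Summable fun i : ℕ => -((p : ℝ))⁻¹ ^ (i + 1) :=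
    ((summable_nat_add_iff 1).2 (summable_geometric_of_lt_one (by positivity) hq)).neg
  simpa [clC, sub_eq_add_neg] using
    (Real.multipliable_one_add_of_summable hs).hasProd.tendsto_prod_nat

theorem one_sub_inv_pow_nonneg {p : ℕ} (hp : p.Prime) (i : ℕ) :
    0 ≤ 1 - ((p : ℝ))⁻¹ ^ (i + 1) :=
  sub_nonneg.2 (pow_le_one₀ (by positivity)
    (inv_le_one_of_one_le₀ (by exact_mod_cast hp.one_lt.le)))

theorem clC_nonneg {p : ℕ} (hp : p.Prime) : 0 ≤ clC p :=
  ge_of_tendsto' (tendsto_prod_clC hp) fun _ =>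
    Finset.prod_nonneg fun i _ => one_sub_inv_pow_nonneg hp i

theorem one_half_le_clC {p : ℕ} (hp : p.Prime) (hp3 : 3 ≤ p) : 1 / 2 ≤ clC p := by
  refine ge_of_tendsto' (tendsto_prod_clC hp) fun n => ?_
  have hq0 : (0 : ℝ) ≤ (p : ℝ)⁻¹ := by positivity
  have hq : (p : ℝ)⁻¹ ≤ 1 / 3 := by
    rw [one_div]
    exact inv_anti₀ (by norm_num) (by exact_mod_cast hp3)
  suffices h : 1 / 2 + (p : ℝ)⁻¹ ^ n / 2 ≤
      ∏ i ∈ Finset.range n, (1 - ((p : ℝ))⁻¹ ^ (i + 1)) by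
    have := pow_nonneg hq0 n
    linarith
  induction n with
  | zero => norm_num
  | succ n ih =>
    rw [Finset.prod_range_succ]
    refine le_trans ?_ (mul_le_mul_of_nonneg_right ih (one_sub_inv_pow_nonneg hp n))
    have h1 : (p : ℝ)⁻¹ ^ n ≤ 1 := pow_le_one₀ hq0 (by linarith)
    have h0 : 0 ≤ (p : ℝ)⁻¹ ^ n := pow_nonneg hq0 n
    have h2 : (p : ℝ)⁻¹ ^ (n + 1) ≤ (p : ℝ)⁻¹ ^ n / 3 := by
      rw [pow_succ]
      nlinarith
    nlinarith [pow_nonneg hq0 (n + 1)]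

theorem sum_wCL_mul_clC_le_one {p : ℕ} (hp : p.Prime) (L : Finset PartitionsAll) :
    (∑ lam ∈ L, wCL p lam) * clC p ≤ 1 := by
  have : NeZero p := ⟨hp.ne_zero⟩
  let g (n : ℕ) (lam : PartitionsAll) : ℝ :=
    (Nat.card {v : Fin n → pGroup p lam //
        Function.Surjective (Fintype.linearCombination ℤ v)} : ℝ) *
        ((Nat.card (pGroup p lam) : ℝ)⁻¹) ^ n
  have hlim : Tendsto (fun n => (∑ lam ∈ L, wCL p lam * g n lam) *
      ∏ i ∈ Finset.range n, (1 - ((p : ℝ))⁻¹ ^ (i + 1))) atTop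
      (𝓝 ((∑ lam ∈ L, wCL p lam * 1) * clC p)) :=
    (tendsto_finsetSum _ fun lam _ => tendsto_card_generating_div.const_mul _).mul
      (tendsto_prod_clC hp)
  simp only [mul_one] at hlim
  refine le_of_tendsto' hlim fun n => ?_
  have h := ENNReal.le_inv_iff_mul_le.1
    ((sum_wCL_generating_le hp L n).trans (subgroupZeta_int_pow_le hp n))
  have h' := ENNReal.toReal_mono ENNReal.one_ne_top h
  have hfin (lam : PartitionsAll) : Finite (AddAut (pGroup p lam)) := DFunLike.finite _
  rw [ENNReal.toReal_mul, ENNReal.toReal_prod, ENNReal.toReal_sum, ENNReal.toReal_one] at h'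
  · refine le_of_eq_of_le (congrArg₂ _ ?_ ?_) h'
    · refine Finset.sum_congr rfl fun lam _ => ?_
      simp only [g, wCL, ENNReal.toReal_mul, ENNReal.toReal_pow, ENNReal.toReal_inv,
        ENNReal.toReal_natCast]
      ring
    · refine Finset.prod_congr rfl fun i _ => ?_
      rw [ENNReal.toReal_sub_of_le _ ENNReal.one_ne_top]
      · simp
      · exact pow_le_one₀ (by simp) (ENNReal.inv_le_one.2 (by exact_mod_cast hp.one_lt.le))
  · intro lam _
    refine ENNReal.mul_ne_top (by simp) (ENNReal.mul_ne_top ?_ (ENNReal.pow_ne_top ?_)) <;>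
    exact ENNReal.inv_ne_top.2 (by exact_mod_cast Nat.card_pos.ne')

theorem summable_wCL_mul_clC {p : ℕ} (hp : p.Prime) :
    Summable fun lam => wCL p lam * clC p :=
  summable_of_sum_le (fun lam => mul_nonneg (wCL_nonneg p lam) (clC_nonneg hp))
    fun L => by rw [← Finset.sum_mul]; exact sum_wCL_mul_clC_le_one hp L

theorem Pp_eq_tsum (p : ℕ) (S : Set PartitionsAll) :
    Pp p S = ∑' lam : S, wCL p lam * clC p := tsum_mul_right.symm

theorem Pp_univ_le_one {p : ℕ} (hp : p.Prime) :
    ∑' lam, wCL p lam * clC p ≤ 1 :=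
  (summable_wCL_mul_clC hp).tsum_le_of_sum_le
    fun L => by rw [← Finset.sum_mul]; exact sum_wCL_mul_clC_le_one hp L

theorem Pp_le_one {p : ℕ} (hp : p.Prime) (S : Set PartitionsAll) : Pp p S ≤ 1 := by
  rw [Pp_eq_tsum]
  exact (Summable.tsum_subtype_le (fun lam => wCL p lam * clC p) S
    (fun lam => mul_nonneg (wCL_nonneg p lam) (clC_nonneg hp))
    (summable_wCL_mul_clC hp)).trans (Pp_univ_le_one hp)

theorem wCL_zero (p : ℕ) : wCL p 0 = 1 := by
  have : IsEmpty (Fin (0 : PartitionsAll).2.parts.toList.length) := by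
    change IsEmpty (Fin (0 : Multiset ℕ).toList.length)
    rw [Multiset.toList_zero]
    exact Fin.isEmpty
  simp [wCL]

theorem Pp_le_one_half {p : ℕ} (hp : p.Prime) (hp3 : 3 ≤ p) {S : Set PartitionsAll}
    (hS : 0 ∉ S) : Pp p S ≤ 1 / 2 := by
  have hsum := summable_wCL_mul_clC hp
  have hle : Pp p S ≤ Pp p {0}ᶜ := by
    rw [Pp_eq_tsum, Pp_eq_tsum, tsum_subtype S (fun lam => wCL p lam * clC p),
      tsum_subtype {0}ᶜ (fun lam => wCL p lam * clC p)]
    refine Summable.tsum_le_tsum (fun lam => ?_) (hsum.indicator _) (hsum.indicator _)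
    exact Set.indicator_le_indicator_of_subset (Set.subset_compl_singleton_iff.2 hS)
      (fun lam => mul_nonneg (wCL_nonneg p lam) (clC_nonneg hp)) lam
  have hadd : clC p + Pp p {0}ᶜ = ∑' lam, wCL p lam * clC p := by
    rw [Pp_eq_tsum, ← hsum.tsum_subtype_add_tsum_subtype_compl {0}]
    simp [wCL_zero]
  linarith [Pp_univ_le_one hp, one_half_le_clC hp hp3]

theorem prime_of_mem_primesUpTo {p x : ℕ} (h : p ∈ primesUpTo x) : p.Prime :=
  Nat.prime_of_mem_primesBelow h

theorem globPartial_nonneg (S : Set PartitionsAll) (x : ℕ) : 0 ≤ globPartial S x :=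
  Finset.prod_nonneg fun _ hp => Pp_nonneg (prime_of_mem_primesUpTo hp) S

theorem tendsto_globPartial (S : Set PartitionsAll) :
    Tendsto (globPartial S) atTop (𝓝 (glob S)) := by
  have hanti : Antitone (globPartial S) := fun x y hxy =>
    Finset.prod_le_prod_of_subset_of_le_one
      (Finset.filter_subset_filter _ (Finset.range_mono (Nat.succ_le_succ hxy)))
      (fun p hp => Pp_nonneg (prime_of_mem_primesUpTo hp) S)
      (fun p hp _ => Pp_le_one (prime_of_mem_primesUpTo hp) S)
  exact tendsto_nhds_limUnder ⟨_, tendsto_atTop_ciInf hanti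
    ⟨0, Set.forall_mem_range.2 (globPartial_nonneg S)⟩⟩

theorem glob_eq_zero {S : Set PartitionsAll} (hS : 0 ∉ S) : glob S = 0 := by
  have hle (x : ℕ) : globPartial S x ≤ (1 / 2 : ℝ) ^ (Nat.primeCounting x - 1) := by
    calc globPartial S x ≤ ∏ p ∈ (primesUpTo x).erase 2, Pp p S :=
          Finset.prod_le_prod_of_subset_of_le_one (Finset.erase_subset _ _)
            (fun p hp => Pp_nonneg (prime_of_mem_primesUpTo hp) S)
            (fun p hp _ => Pp_le_one (prime_of_mem_primesUpTo hp) S)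
      _ ≤ ∏ p ∈ (primesUpTo x).erase 2, (1 / 2 : ℝ) := by
          refine Finset.prod_le_prod (fun p hp =>
            Pp_nonneg (prime_of_mem_primesUpTo (Finset.mem_of_mem_erase hp)) S) fun p hp => ?_
          have hpp := prime_of_mem_primesUpTo (Finset.mem_of_mem_erase hp)
          exact Pp_le_one_half hpp
            (lt_of_le_of_ne hpp.two_le (Finset.ne_of_mem_erase hp).symm) hS
      _ ≤ _ := by
          rw [Finset.prod_const]
          refine pow_le_pow_of_le_one (by norm_num) (by norm_num) ?_
          have : (primesUpTo x).card = Nat.primeCounting x := by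
            rw [primesUpTo, Nat.primesBelow_card_eq_primeCounting', Nat.primeCounting]
          rw [← this]
          exact Finset.pred_card_le_card_erase
  refine tendsto_nhds_unique (tendsto_globPartial S) ?_
  refine squeeze_zero (globPartial_nonneg S) hle ?_
  exact (tendsto_pow_atTop_nhds_zero_of_lt_one (by norm_num) (by norm_num)).comp
    ((tendsto_sub_atTop_nat 1).comp Nat.tendsto_primeCounting)

theorem globPartial_eq_prod (S : Set PartitionsAll) (x : ℕ) :
    globPartial S x = ∏ q : primesUpTo x, Pp q S := (Finset.prod_coe_sort _ _).symm

instance : MeasurableSpace PartitionsAll := ⊤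

instance : Countable PartitionsAll := inferInstanceAs (Countable (Σ n : ℕ, Nat.Partition n))

instance : MeasurableSpace GG := ⊤

/-- The local Cohen–Lenstra measure on partitions. -/
noncomputable def localMeasure (p : ℕ) : MeasureTheory.Measure PartitionsAll :=
  MeasureTheory.Measure.sum fun lam =>
    ENNReal.ofReal (wCL p lam * clC p) • MeasureTheory.Measure.dirac lam

theorem localMeasure_apply {p : ℕ} (hp : p.Prime) (S : Set PartitionsAll) :
    localMeasure p S = ENNReal.ofReal (Pp p S) := by
  have hnn (lam : PartitionsAll) : 0 ≤ wCL p lam * clC p :=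
    mul_nonneg (wCL_nonneg p lam) (clC_nonneg hp)
  rw [Pp_eq_tsum, tsum_subtype S (fun lam => wCL p lam * clC p),
    ENNReal.ofReal_tsum_of_nonneg (fun lam => Set.indicator_nonneg (fun _ _ => hnn _) lam)
      ((summable_wCL_mul_clC hp).indicator S), localMeasure,
    MeasureTheory.Measure.sum_apply _ MeasurableSpace.measurableSet_top]
  refine tsum_congr fun lam => ?_
  rw [MeasureTheory.Measure.smul_apply,
    MeasureTheory.Measure.dirac_apply' _ MeasurableSpace.measurableSet_top]
  by_cases h : lam ∈ S <;> simp [h]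

/-- Extend a family of partitions indexed by the primes `≤ x` by the empty partition. -/
noncomputable def extendZero (x : ℕ) (g : primesUpTo x → PartitionsAll) : GG :=
  Finsupp.ofSupportFinite
    (fun q : Nat.Primes => if h : (q : ℕ) ∈ primesUpTo x then g ⟨q, h⟩ else 0)
    (((primesUpTo x).finite_toSet.preimage Subtype.val_injective.injOn).subset fun q hq => by
      by_contra h
      exact hq (dif_neg h))

theorem extendZero_mem_Oset {x : ℕ} {g : primesUpTo x → PartitionsAll} {S : Set PartitionsAll} :
    extendZero x g ∈ Oset S ↔ 0 ∈ S ∧ ∀ q, g q ∈ S := by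
  change (∀ q : Nat.Primes, (if h : (q : ℕ) ∈ primesUpTo x then g ⟨q, h⟩ else 0) ∈ S) ↔ _
  constructor
  · intro h
    refine ⟨?_, fun q => ?_⟩
    · obtain ⟨q, hq, hqp⟩ := Nat.exists_infinite_primes (x + 1)
      have hmem : q ∉ primesUpTo x := fun hm => (Nat.lt_of_mem_primesBelow hm).not_ge hq
      simpa only [dif_neg hmem] using h ⟨q, hqp⟩
    · have := h ⟨q, prime_of_mem_primesUpTo q.2⟩
      rwa [dif_pos q.2] at this
  · rintro ⟨h0, h⟩ q
    split_ifs
    · exact h _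
    · exact h0

/-- The product of the local Cohen–Lenstra measures at the primes `≤ x`, transported to `GG`. -/
noncomputable def truncMeasure (x : ℕ) : MeasureTheory.Measure GG :=
  (MeasureTheory.Measure.pi fun q : primesUpTo x => localMeasure q).map (extendZero x)

theorem isFiniteMeasure_localMeasure {p : ℕ} (hp : p.Prime) :
    MeasureTheory.IsFiniteMeasure (localMeasure p) :=
  ⟨by rw [localMeasure_apply hp]; exact ENNReal.ofReal_lt_top⟩

instance (x : ℕ) (q : primesUpTo x) : MeasureTheory.IsFiniteMeasure (localMeasure q) :=
  isFiniteMeasure_localMeasure (prime_of_mem_primesUpTo q.2)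

instance (x : ℕ) : MeasureTheory.IsFiniteMeasure (truncMeasure x) := by
  unfold truncMeasure
  infer_instance

theorem truncMeasure_real_Oset (x : ℕ) {S : Set PartitionsAll} (hS : 0 ∈ S) :
    (truncMeasure x).real (Oset S) = globPartial S x := by
  have hpre : extendZero x ⁻¹' Oset S = Set.univ.pi fun _ => S := by
    ext g
    simp [extendZero_mem_Oset, hS]
  rw [MeasureTheory.Measure.real, truncMeasure,
    MeasureTheory.Measure.map_apply .of_discrete MeasurableSpace.measurableSet_top, hpre,
    MeasureTheory.Measure.pi_pi,
    ENNReal.toReal_prod, globPartial_eq_prod]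
  refine Finset.prod_congr rfl fun q _ => ?_
  have hq := prime_of_mem_primesUpTo q.2
  rw [localMeasure_apply hq, ENNReal.toReal_ofReal (Pp_nonneg hq S)]

theorem tendsto_truncMeasure_Oset (S : Set PartitionsAll) :
    Tendsto (fun x => (truncMeasure x).real (Oset S)) atTop (𝓝 (glob S)) := by
  by_cases hS : 0 ∈ S
  · simp_rw [truncMeasure_real_Oset _ hS]
    exact tendsto_globPartial S
  · have hempty : Oset S = ∅ := by
      ext G
      refine iff_of_false (fun hG => hS ?_) (Set.notMem_empty G)
      obtain ⟨q, hq⟩ := Infinite.exists_notMem_finset G.support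
      exact Finsupp.notMem_support_iff.1 hq ▸ hG q
    simp [hempty, glob_eq_zero hS]

theorem tendsto_truncMeasure_OOset {r : ℕ} (E : Fin r → Set PartitionsAll) :
    Tendsto (fun x => (truncMeasure x).real (OOset E)) atTop (𝓝 (PO E)) := by
  have hinter (T : Finset (Fin r)) : ⋂ i ∈ T, Oset (E i) = Oset (⋂ i ∈ T, E i) := by
    ext G
    simp only [Oset, Set.mem_iInter, Set.mem_ofPred_eq]
    exact ⟨fun h q i hi => h i hi q, fun h i hi q => h q i hi⟩
  have hPO (x : ℕ) : (truncMeasure x).real (OOset E) =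
      ∑ T ∈ Finset.univ.filter (fun T : Finset (Fin r) => T.Nonempty),
        (-1 : ℝ) ^ (T.card + 1) * (truncMeasure x).real (Oset (⋂ i ∈ T, E i)) := by
    have := MeasureTheory.measureReal_biUnion_eq_sum_powerset (μ := truncMeasure x)
      (t := Finset.univ) (s := fun i => Oset (E i)) (fun _ _ => trivial)
    simpa [OOset, hinter] using this
  simp_rw [hPO]
  exact tendsto_finsetSum _ fun T _ => (tendsto_truncMeasure_Oset _).const_mul _

theorem tendsto_truncMeasure_diff {r s : ℕ} {E : Fin r → Set PartitionsAll}
    {F : Fin s → Set PartitionsAll} (h : OOset F ⊆ OOset E) :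
    Tendsto (fun x => (truncMeasure x).real (OOset E \ OOset F)) atTop (𝓝 (PO E - PO F)) := by
  have hdiff (x : ℕ) : (truncMeasure x).real (OOset E \ OOset F) =
      (truncMeasure x).real (OOset E) - (truncMeasure x).real (OOset F) :=
    MeasureTheory.measureReal_sdiff h trivial
  simp_rw [hdiff]
  exact (tendsto_truncMeasure_OOset E).sub (tendsto_truncMeasure_OOset F)

/-- If `D₁, …, D_n ∈ 𝔇` are mutually disjoint and contained in `D₀ ∈ 𝔇`, then
`∑ᵢ P(Dᵢ) ≤ P(D₀)`; in particular `P` is monotone on `𝔇`. -/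
theorem PD_sum_le_of_disjoint_subset :
    (∀ (n r0 s0 : ℕ) (E0 : Fin r0 → Set PartitionsAll) (F0 : Fin s0 → Set PartitionsAll)
        (r s : Fin n → ℕ) (E : ∀ i, Fin (r i) → Set PartitionsAll)
        (F : ∀ i, Fin (s i) → Set PartitionsAll),
        OOset F0 ⊆ OOset E0 →
        (∀ i, OOset (F i) ⊆ OOset (E i)) →
        Pairwise (fun i j =>
          Disjoint (OOset (E i) \ OOset (F i)) (OOset (E j) \ OOset (F j))) →
        (⋃ i, OOset (E i) \ OOset (F i)) ⊆ OOset E0 \ OOset F0 →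
        ∑ i, (PO (E i) - PO (F i)) ≤ PO E0 - PO F0) ∧
    (∀ (r0 s0 r1 s1 : ℕ)
        (E0 : Fin r0 → Set PartitionsAll) (F0 : Fin s0 → Set PartitionsAll)
        (E1 : Fin r1 → Set PartitionsAll) (F1 : Fin s1 → Set PartitionsAll),
        OOset F0 ⊆ OOset E0 → OOset F1 ⊆ OOset E1 →
        OOset E1 \ OOset F1 ⊆ OOset E0 \ OOset F0 →
        PO E1 - PO F1 ≤ PO E0 - PO F0) := by
  refine ⟨fun n r0 s0 E0 F0 r s E F h0 h hdisj hsub => ?_,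
    fun r0 s0 r1 s1 E0 F0 E1 F1 h0 h1 hsub => ?_⟩
  · refine le_of_tendsto_of_tendsto'
      (tendsto_finsetSum _ fun i _ => tendsto_truncMeasure_diff (h i))
      (tendsto_truncMeasure_diff h0) fun x => ?_
    rw [← MeasureTheory.measureReal_iUnion_fintype hdisj fun _ => trivial]
    exact MeasureTheory.measureReal_mono hsub
  · exact le_of_tendsto_of_tendsto' (tendsto_truncMeasure_diff h1) (tendsto_truncMeasure_diff h0)
      fun x => MeasureTheory.measureReal_mono hsub
end
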